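/- Let a, b > 0 satisfy the nine inequalities 2a + b ≥ 1, 3a + 4b ≥ 2, 9a + 11b ≥ 6, a + 5b ≥ 1, 4a + 9b ≥ 3, 10a + 16b ≥ 7, 13a + 20b ≥ 8, 5a + 14b ≥ 4, a + (3/2)b ≥ 2/3. Let G be a graph with no triangle adjacent to a 4-cycle such that α(G) < |V(G)| − (a|V(G)| + b|E(G)| + bλ(G)), and suppose every graph G' with fewer vertices than G and no triangle adjacent to a 4-cycle satisfies α(G') ≥ |V(G')| − (a|V(G')| + b|E(G')| + bλ(G')). Then no vertex of degree three in G has a neighbor of degree four. -/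

import Mathlib

namespace Paper

/-- `s` is an independent set in the simple graph `G`. -/
def IsIndepSet {V : Type} (G : SimpleGraph V) (s : Finset V) : Prop :=
  ∀ v ∈ s, ∀ w ∈ s, ¬ G.Adj v w

/-- The independence number `α(G)`: the size of a largest independent set. -/
noncomputable def indepNum {V : Type} (G : SimpleGraph V) : ℕ :=
  sSup {n | ∃ s : Finset V, IsIndepSet G s ∧ s.card = n}

/-- The number of edges `|E(G)|`. -/
noncomputable def numEdges {V : Type} (G : SimpleGraph V) : ℕ :=
  Nat.card G.edgeSet

/-- The degree of a vertex. -/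
noncomputable def deg {V : Type} (G : SimpleGraph V) (v : V) : ℕ :=
  Nat.card (G.neighborSet v)

/-- `G` contains a triangle sharing a common edge with a 4-cycle:
the triangle `u v w` and the 4-cycle `u v x y` share the edge `u v`. -/
def HasTriangleAdjC4 {V : Type} (G : SimpleGraph V) : Prop :=
  ∃ u v w x y : V, G.Adj u v ∧ G.Adj v w ∧ G.Adj w u ∧
    G.Adj v x ∧ G.Adj x y ∧ G.Adj y u ∧ u ≠ x ∧ v ≠ y

/-- `G` contains two triangles sharing a common edge:
the triangles `u v w` and `u v x` share the edge `u v`. -/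
def HasAdjTriangles {V : Type} (G : SimpleGraph V) : Prop :=
  ∃ u v w x : V, G.Adj u v ∧ G.Adj v w ∧ G.Adj w u ∧
    G.Adj v x ∧ G.Adj x u ∧ w ≠ x

/-- `G` contains a triangle sharing a common edge with a 5-cycle:
the triangle `u v w` and the 5-cycle `u v x y z` share the edge `u v`. -/
def HasTriangleAdjC5 {V : Type} (G : SimpleGraph V) : Prop :=
  ∃ u v w x y z : V, G.Adj u v ∧ G.Adj v w ∧ G.Adj w u ∧
    G.Adj v x ∧ G.Adj x y ∧ G.Adj y z ∧ G.Adj z u ∧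
    u ≠ x ∧ u ≠ y ∧ v ≠ y ∧ v ≠ z ∧ x ≠ z

/-- The 2-chain of triangles: two disjoint triangles `{0,1,2}` and `{3,4,5}`
joined by the single edge `{2,3}` (6 vertices, 7 edges). -/
def chainGraph : SimpleGraph (Fin 6) :=
  SimpleGraph.fromRel (fun i j =>
    (i.val, j.val) ∈ [(0,1), (0,2), (1,2), (3,4), (3,5), (4,5), (2,3)])

/-- A connected component is difficult if it is a triangle or a 2-chain of triangles. -/
def IsDifficult {V : Type} (G : SimpleGraph V) (c : G.ConnectedComponent) : Prop :=
  Nonempty (SimpleGraph.induce c.supp G ≃g (⊤ : SimpleGraph (Fin 3))) ∨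
  Nonempty (SimpleGraph.induce c.supp G ≃g chainGraph)

/-- `λ(G)`: the number of difficult components of `G`. -/
noncomputable def lambda {V : Type} (G : SimpleGraph V) : ℕ :=
  Nat.card {c : G.ConnectedComponent // IsDifficult G c}

/-- `Φ(S)`: the number of edges of `G` with exactly one endpoint in `S`. -/
noncomputable def phi {V : Type} (G : SimpleGraph V) (S : Set V) : ℕ :=
  Nat.card {e : Sym2 V | e ∈ G.edgeSet ∧ ∃ x ∈ S, ∃ y, y ∉ S ∧ e = s(x, y)}

section

open scoped Classical

variable {V : Type} {G : SimpleGraph V} {S A B : Finset V}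

/-- The number of neighbors of `v` in `S`. -/
noncomputable def degIn (G : SimpleGraph V) (S : Finset V) (v : V) : ℕ :=
  (S.filter (G.Adj v)).card

theorem degIn_eq_sum (S : Finset V) (v : V) :
    degIn G S v = ∑ w ∈ S, if G.Adj v w then 1 else 0 := by
  simp [degIn]

theorem sum_degIn_comm (S T : Finset V) :
    ∑ v ∈ S, degIn G T v = ∑ v ∈ T, degIn G S v := by
  simp only [degIn_eq_sum]
  rw [Finset.sum_comm]
  simp only [G.adj_comm]

theorem degIn_union (h : Disjoint A B) (v : V) :
    degIn G (A ∪ B) v = degIn G A v + degIn G B v := by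
  simp only [degIn_eq_sum, Finset.sum_union h]

theorem HasTriangleAdjC4.of_embedding {W : Type} {H : SimpleGraph W} (ψ : H ↪g G)
    (h : HasTriangleAdjC4 H) : HasTriangleAdjC4 G := by
  obtain ⟨u, v, w, x, y, h1, h2, h3, h4, h5, h6, h7, h8⟩ := h
  exact ⟨ψ u, ψ v, ψ w, ψ x, ψ y, by simpa using h1, by simpa using h2, by simpa using h3,
    by simpa using h4, by simpa using h5, by simpa using h6, by simpa using h7, by simpa using h8⟩

theorem exists_adj_closed_of_preconnected {n : ℕ} {F : SimpleGraph (Fin n)} (hF : F.Preconnected)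
    {P : Fin n → Prop} (hP : ∀ i j, F.Adj i j → P i → P j) {i : Fin n} (hi : P i) (j : Fin n) :
    P j := by
  obtain ⟨p⟩ := hF i j
  induction p with
  | nil => exact hi
  | cons h _ ih => exact ih (hP _ _ h hi)

instance : DecidableRel chainGraph.Adj := fun i j =>
  decidable_of_iff _ (SimpleGraph.fromRel_adj _ i j).symm

theorem chainGraph_preconnected : chainGraph.Preconnected := by
  have h : ∀ i : Fin 6, chainGraph.Reachable 2 i := by
    have h20 : chainGraph.Adj 2 0 := by decide
    have h21 : chainGraph.Adj 2 1 := by decide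
    have h23 : chainGraph.Adj 2 3 := by decide
    have h34 : chainGraph.Adj 3 4 := by decide
    have h35 : chainGraph.Adj 3 5 := by decide
    intro i
    fin_cases i
    · exact h20.reachable
    · exact h21.reachable
    · exact SimpleGraph.Reachable.refl _
    · exact h23.reachable
    · exact h23.reachable.trans h34.reachable
    · exact h23.reachable.trans h35.reachable
  exact fun i j => (h i).symm.trans (h j)

theorem supp_eq_range_of_closed {W : Type} {H : SimpleGraph W} {n : ℕ} {F : SimpleGraph (Fin n)}
    (hF : F.Preconnected) (φ : F ↪g H) (i : Fin n)
    (hclosed : ∀ j y, H.Adj (φ j) y → y ∈ Set.range φ) :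
    (H.connectedComponentMk (φ i)).supp = Set.range φ := by
  apply Set.Subset.antisymm
  · intro x hx
    rw [SimpleGraph.ConnectedComponent.mem_supp_iff, SimpleGraph.ConnectedComponent.eq] at hx
    obtain ⟨p⟩ := hx.symm
    have key : ∀ u v (_ : H.Walk u v), u ∈ Set.range φ → v ∈ Set.range φ := by
      intro u v p
      induction p with
      | nil => exact id
      | cons h _ ih =>
        rintro ⟨j, rfl⟩
        exact ih (hclosed j _ h)
    exact key _ _ p ⟨i, rfl⟩
  · rintro _ ⟨j, rfl⟩
    rw [SimpleGraph.ConnectedComponent.mem_supp_iff, SimpleGraph.ConnectedComponent.eq]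
    exact (hF j i).map φ.toHom

/-- The vertex set `A` induces a copy of `F` in `G`. -/
def IsCopy {n : ℕ} (F : SimpleGraph (Fin n)) (G : SimpleGraph V) (A : Finset V) : Prop :=
  ∃ φ : F ↪g G, A = Finset.univ.map φ.toEmbedding

/-- The vertex set `A` carries a difficult component of `G - S`. -/
structure IsDifficultMod (G : SimpleGraph V) (S A : Finset V) : Prop where
  disjoint : Disjoint A S
  copy : IsCopy (⊤ : SimpleGraph (Fin 3)) G A ∨ IsCopy chainGraph G A
  closed : ∀ x ∈ A, ∀ y, G.Adj x y → y ∉ S → y ∈ A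

/-- `K` is an independent subset of `S` all of whose neighbors lie in `S`, so that
it extends every independent set of `G - S`. -/
structure IsExtension (G : SimpleGraph V) (S K : Finset V) : Prop where
  subset : K ⊆ S
  indep : IsIndepSet G K
  closed : ∀ x ∈ K, ∀ y, G.Adj x y → y ∈ S

theorem IsCopy.subset_of_closed {n : ℕ} {F : SimpleGraph (Fin n)} (hF : F.Preconnected)
    (hA : IsCopy F G A) (hd : Disjoint A S)
    (hB : ∀ x ∈ B, ∀ y, G.Adj x y → y ∉ S → y ∈ B) {x : V} (hxA : x ∈ A) (hxB : x ∈ B) :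
    A ⊆ B := by
  obtain ⟨φ, rfl⟩ := hA
  obtain ⟨i, -, rfl⟩ := Finset.mem_map.1 hxA
  intro y hy
  obtain ⟨j, -, rfl⟩ := Finset.mem_map.1 hy
  refine exists_adj_closed_of_preconnected (P := fun i => φ i ∈ B) hF ?_ hxB j
  intro i j hij hi
  exact hB _ hi _ (φ.map_adj_iff.2 hij)
    (Finset.disjoint_left.1 hd (Finset.mem_map_of_mem _ (Finset.mem_univ j)))

theorem IsDifficultMod.subset (hA : IsDifficultMod G S A) (hB : IsDifficultMod G S B) {x : V}
    (hxA : x ∈ A) (hxB : x ∈ B) : A ⊆ B := by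
  rcases hA.copy with h | h
  · exact h.subset_of_closed SimpleGraph.preconnected_top hA.disjoint hB.closed hxA hxB
  · exact h.subset_of_closed chainGraph_preconnected hA.disjoint hB.closed hxA hxB

theorem IsDifficultMod.disjoint_of_ne (hA : IsDifficultMod G S A) (hB : IsDifficultMod G S B)
    (hne : A ≠ B) : Disjoint A B := by
  rw [Finset.disjoint_left]
  intro x hxA hxB
  exact hne ((hA.subset hB hxA hxB).antisymm (hB.subset hA hxB hxA))

theorem IsDifficultMod.nonempty (hA : IsDifficultMod G S A) : A.Nonempty := by
  rcases hA.copy with ⟨φ, rfl⟩ | ⟨φ, rfl⟩ <;> simp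

/-- The vertices of `A` with a neighbor in `S`. -/
noncomputable def boundaryIn (G : SimpleGraph V) (S A : Finset V) : Finset V :=
  A.filter fun x => ∃ s ∈ S, G.Adj x s

theorem mem_boundaryIn {x : V} : x ∈ boundaryIn G S A ↔ x ∈ A ∧ ∃ s ∈ S, G.Adj x s := by
  simp [boundaryIn]

theorem IsExtension.union {K L : Finset V} (hK : IsExtension G S K) (hA : IsDifficultMod G S A)
    (hL : L ⊆ A) (hLi : IsIndepSet G L) : IsExtension G (S ∪ A) (K ∪ L) := by
  have hKL : ∀ x ∈ K, ∀ y ∈ L, ¬ G.Adj x y := fun x hx y hy hxy =>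
    Finset.disjoint_left.1 hA.disjoint (hL hy) (hK.closed x hx y hxy)
  refine ⟨Finset.union_subset_union hK.subset hL, ?_, ?_⟩
  · intro x hx y hy hxy
    rcases Finset.mem_union.1 hx with hx | hx <;> rcases Finset.mem_union.1 hy with hy | hy
    · exact hK.indep x hx y hy hxy
    · exact hKL x hx y hy hxy
    · exact hKL y hy x hx hxy.symm
    · exact hLi x hx y hy hxy
  · intro x hx y hxy
    rcases Finset.mem_union.1 hx with hx | hx
    · exact Finset.mem_union_left _ (hK.closed x hx y hxy)
    · by_cases hy : y ∈ S
      · exact Finset.mem_union_left _ hy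
      · exact Finset.mem_union_right _ (hA.closed x (hL hx) y hxy hy)

theorem degIn_map {n : ℕ} {F : SimpleGraph (Fin n)} [DecidableRel F.Adj] (φ : F ↪g G)
    (i : Fin n) :
    degIn G (Finset.univ.map φ.toEmbedding) (φ i) = (Finset.univ.filter (F.Adj i)).card := by
  rw [degIn, Finset.filter_map, Finset.card_map]
  congr 1
  ext j
  simp

theorem eq_of_adjacent_triangles (hC : ¬ HasTriangleAdjC4 G) {p q r s : V} (hpq : G.Adj p q)
    (hqr : G.Adj q r) (hrp : G.Adj r p) (hps : G.Adj p s) (hqs : G.Adj q s) : r = s := by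
  by_contra hne
  exact hC ⟨p, r, q, q, s, hrp.symm, hqr.symm, hpq.symm, hqr.symm, hqs, hps.symm, hpq.ne, hne⟩

theorem not_triangle_of_adj_of_adj (hC : ¬ HasTriangleAdjC4 G) {p q r s t : V} (hpq : G.Adj p q)
    (hqr : G.Adj q r) (hrp : G.Adj r p) (hps : G.Adj p s) (hqt : G.Adj q t) (hst : G.Adj s t)
    (hsq : s ≠ q) (htp : t ≠ p) : False :=
  hC ⟨p, q, r, t, s, hpq, hqr, hrp, hqt, hst.symm, hps.symm, htp.symm, hsq.symm⟩

theorem IsCopy.exists_triangle (h : IsCopy (⊤ : SimpleGraph (Fin 3)) G A) {w : V} (hw : w ∈ A) :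
    ∃ s t, A = {w, s, t} ∧ G.Adj w s ∧ G.Adj w t ∧ G.Adj s t := by
  obtain ⟨φ, rfl⟩ := h
  obtain ⟨i, -, rfl⟩ := Finset.mem_map.1 hw
  have hadj : ∀ i j, i ≠ j → G.Adj (φ i) (φ j) := fun i j h => φ.map_adj_iff.2 h
  refine ⟨φ (i + 1), φ (i + 2), ?_, hadj _ _ ?_, hadj _ _ ?_, hadj _ _ ?_⟩
  · ext x
    simp only [Finset.mem_map, Finset.mem_univ, true_and, Finset.mem_insert,
      Finset.mem_singleton, RelEmbedding.coe_toEmbedding]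
    have : ∀ i j : Fin 3, j = i ∨ j = i + 1 ∨ j = i + 2 := by decide
    constructor
    · rintro ⟨j, rfl⟩
      rcases this i j with h | h | h <;> simp [h]
    · rintro (rfl | rfl | rfl) <;> exact ⟨_, rfl⟩
  all_goals clear hw; revert i; decide

theorem isCopy_of_lt {n : ℕ} {F : SimpleGraph (Fin n)} (f : Fin n → V)
    (hf : ∀ i j, i < j → f i ≠ f j ∧ (G.Adj (f i) (f j) ↔ F.Adj i j))
    (hA : A = Finset.univ.image f) : IsCopy F G A := by
  refine ⟨⟨⟨f, fun i j hij => ?_⟩, fun {i j} => ?_⟩, ?_⟩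
  · rcases lt_trichotomy i j with h | h | h
    · exact absurd hij (hf i j h).1
    · exact h
    · exact absurd hij.symm (hf j i h).1
  · rcases lt_trichotomy i j with h | rfl | h
    · exact (hf i j h).2
    · simp
    · exact (G.adj_comm _ _).trans ((hf j i h).2.trans (F.adj_comm _ _))
  · rw [hA, Finset.map_eq_image]
    rfl

theorem isCopy_triangle {p q r : V} (hpq : G.Adj p q) (hqr : G.Adj q r) (hpr : G.Adj p r) :
    IsCopy (⊤ : SimpleGraph (Fin 3)) G {p, q, r} := by
  have := hpq.ne
  have := hqr.ne
  have := hpr.ne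
  refine isCopy_of_lt ![p, q, r] ?_ ?_
  · intro i j hij
    fin_cases i <;> fin_cases j <;> first
      | exact absurd hij (by decide)
      | exact ⟨by assumption, iff_of_true (by assumption) (by decide)⟩
  · ext x
    simp [Fin.exists_fin_succ, eq_comm]

theorem isCopy_chain {p q r w s t : V} (hpq : G.Adj p q) (hpr : G.Adj p r) (hqr : G.Adj q r)
    (hrw : G.Adj r w) (hws : G.Adj w s) (hwt : G.Adj w t) (hst : G.Adj s t)
    (hp : ∀ z, G.Adj p z → z = q ∨ z = r) (hq : ∀ z, G.Adj q z → z = p ∨ z = r)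
    (hr : ∀ z, G.Adj r z → z = p ∨ z = q ∨ z = w)
    (hd : Disjoint ({w, s, t} : Finset V) {p, q, r}) :
    IsCopy chainGraph G ({p, q, r} ∪ {w, s, t}) := by
  have n1 := hpq.ne
  have n2 := hpr.ne
  have n3 := hqr.ne
  have n4 := hws.ne
  have n5 := hwt.ne
  have n6 := hst.ne
  have n7 := hrw.ne
  simp only [Finset.disjoint_left, Finset.mem_insert, Finset.mem_singleton, forall_eq_or_imp,
    forall_eq, not_or, ← ne_eq] at hd
  obtain ⟨⟨hwp, hwq, hwr⟩, ⟨hsp, hsq, hsr⟩, htp, htq, htr⟩ := hd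
  have h1 : ∀ z, z ≠ q → z ≠ r → ¬ G.Adj p z := fun z h1 h2 h => (hp z h).elim h1 h2
  have h2 : ∀ z, z ≠ p → z ≠ r → ¬ G.Adj q z := fun z h1 h2 h => (hq z h).elim h1 h2
  have h3 : ∀ z, z ≠ p → z ≠ q → z ≠ w → ¬ G.Adj r z := fun z h1 h2 h3 h =>
    (hr z h).elim h1 fun h => h.elim h2 h3
  have h1w := h1 w hwq hwr
  have h1s := h1 s hsq hsr
  have h1t := h1 t htq htr
  have h2w := h2 w hwp hwr
  have h2s := h2 s hsp hsr
  have h2t := h2 t htp htr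
  have h3s := h3 s hsp hsq n4.symm
  have h3t := h3 t htp htq n5.symm
  have hpw := hwp.symm
  have hqw := hwq.symm
  have hps := hsp.symm
  have hqs := hsq.symm
  have hrs := hsr.symm
  have hpt := htp.symm
  have hqt := htq.symm
  have hrt := htr.symm
  clear h1 h2 h3 hp hq hr
  refine isCopy_of_lt ![p, q, r, w, s, t] ?_ ?_
  · intro i j hij
    fin_cases i <;> fin_cases j <;> first
      | exact absurd hij (by decide)
      | exact ⟨by assumption, iff_of_true (by assumption) (by decide)⟩
      | exact ⟨by assumption, iff_of_false (by assumption) (by decide)⟩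
  · ext x
    simp [Fin.exists_fin_succ, eq_comm]
    tauto

theorem isExtension_singleton {v : V} (hv : v ∈ S) (h : ∀ y, G.Adj v y → y ∈ S) :
    IsExtension G S {v} :=
  ⟨by simpa using hv, by simp [IsIndepSet], by simpa using h⟩

theorem IsDifficultMod.adj_iff_of_notMem_boundaryIn {n : ℕ} {F : SimpleGraph (Fin n)}
    {φ : F ↪g G} (hA : IsDifficultMod G S (Finset.univ.map φ.toEmbedding)) {i : Fin n}
    (hi : φ i ∉ boundaryIn G S (Finset.univ.map φ.toEmbedding)) (z : V) :
    G.Adj (φ i) z ↔ ∃ j, F.Adj i j ∧ z = φ j := by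
  have hmem : φ i ∈ Finset.univ.map φ.toEmbedding := Finset.mem_map_of_mem _ (Finset.mem_univ i)
  constructor
  · intro h
    have hz : z ∉ S := fun hz => hi (mem_boundaryIn.2 ⟨hmem, z, hz, h⟩)
    obtain ⟨j, -, rfl⟩ := Finset.mem_map.1 (hA.closed _ hmem z h hz)
    exact ⟨j, φ.map_adj_iff.1 h, rfl⟩
  · rintro ⟨j, hj, rfl⟩
    exact φ.map_adj_iff.2 hj

variable [Fintype V]

/-- The vertex sets of the difficult components of `G - S`. -/
noncomputable def difficultSets (G : SimpleGraph V) (S : Finset V) : Finset (Finset V) :=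
  Finset.univ.filter (IsDifficultMod G S)

/-- Twice the number of edges of `G` incident with a vertex of `S`. -/
noncomputable def twiceIncident (G : SimpleGraph V) (S : Finset V) : ℕ :=
  ∑ v ∈ S, (deg G v + degIn G Sᶜ v)

/-- The number of edges leaving `S`. -/
noncomputable def leaving (G : SimpleGraph V) (S : Finset V) : ℕ :=
  ∑ v ∈ S, degIn G Sᶜ v

/-- The real-parameter conditions describing a minimum counterexample. -/
structure IsMinCounterexample (a b : ℝ) (G : SimpleGraph V) : Prop where
  noTriangleAdjC4 : ¬ HasTriangleAdjC4 G
  counterexample : (indepNum G : ℝ) <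
    (Nat.card V : ℝ) - (a * Nat.card V + b * numEdges G + b * lambda G)
  minimal : ∀ (W : Type) [Fintype W] (G' : SimpleGraph W),
    Nat.card W < Nat.card V → ¬ HasTriangleAdjC4 G' →
    (indepNum G' : ℝ) ≥
      (Nat.card W : ℝ) - (a * Nat.card W + b * numEdges G' + b * lambda G')

theorem deg_eq_degIn_univ (v : V) : deg G v = degIn G Finset.univ v := by
  rw [deg, degIn, Nat.card_eq_fintype_card, ← Set.toFinset_card]
  congr 1
  ext w
  simp

theorem deg_eq_add (S : Finset V) (v : V) : deg G v = degIn G S v + degIn G Sᶜ v := by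
  rw [deg_eq_degIn_univ, degIn_eq_sum, degIn_eq_sum, degIn_eq_sum, Finset.sum_add_sum_compl]

theorem deg_sum_eq_leaving_add (S : Finset V) :
    ∑ v ∈ S, deg G v = ∑ v ∈ S, degIn G S v + leaving G S := by
  rw [leaving, ← Finset.sum_add_distrib]
  exact Finset.sum_congr rfl fun v _ => deg_eq_add S v

theorem twiceIncident_eq (S : Finset V) :
    twiceIncident G S = ∑ v ∈ S, deg G v + leaving G S := by
  rw [leaving, ← Finset.sum_add_distrib, twiceIncident]

/-- Adding a disjoint set `A` to `S` adds at least the edges inside `A` to the incident edges. -/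
theorem twiceIncident_union (h : Disjoint A S) :
    twiceIncident G S + ∑ v ∈ A, degIn G A v ≤ twiceIncident G (S ∪ A) := by
  have e1 : ∀ v, deg G v = degIn G S v + degIn G A v + degIn G (S ∪ A)ᶜ v := fun v => by
    rw [deg_eq_add (S ∪ A), degIn_union h.symm]
  have e2 : ∀ v, degIn G Sᶜ v = degIn G A v + degIn G (S ∪ A)ᶜ v := fun v => by
    have := e1 v
    have := deg_eq_add (G := G) S v
    omega
  have e3 := sum_degIn_comm (G := G) S A
  simp only [twiceIncident, Finset.sum_union h.symm]
  simp only [e1, e2, Finset.sum_add_distrib] at e3 ⊢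
  omega

theorem two_mul_numEdges (H : SimpleGraph V) :
    2 * numEdges H = ∑ v, deg H v := by
  have := H.sum_degrees_eq_twice_card_edges
  rw [numEdges, Nat.card_eq_fintype_card, ← SimpleGraph.edgeFinset_card, ← this]
  refine Finset.sum_congr rfl fun v _ => ?_
  rw [deg, Nat.card_eq_fintype_card, SimpleGraph.card_neighborSet_eq_degree]

theorem deg_induce (S : Finset V) (v : ((S : Set V)ᶜ : Set V)) :
    deg (G.induce ((S : Set V)ᶜ)) v = degIn G Sᶜ v := by
  rw [deg_eq_degIn_univ, degIn, degIn]
  refine Finset.card_bij (fun w _ => (w : V)) ?_ ?_ ?_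
  · intro w hw
    have hw' : (w : V) ∉ S := w.2
    simp_all
  · intro x _ y _ h
    exact Subtype.ext h
  · intro w hw
    simp only [Finset.mem_filter, Finset.mem_compl] at hw
    exact ⟨⟨w, by simpa using hw.1⟩, by simpa using hw.2, rfl⟩

theorem two_mul_numEdges_induce (S : Finset V) :
    2 * numEdges G = 2 * numEdges (G.induce ((S : Set V)ᶜ)) + twiceIncident G S := by
  rw [two_mul_numEdges, two_mul_numEdges]
  simp only [deg_induce]
  have e1 : ∑ v : ((S : Set V)ᶜ : Set V), degIn G Sᶜ v = ∑ v ∈ Sᶜ, degIn G Sᶜ v := by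
    rw [← Finset.sum_subtype Sᶜ (p := fun v => v ∈ ((S : Set V)ᶜ : Set V)) (by simp)]
  rw [e1, twiceIncident, ← Finset.sum_add_sum_compl S, Finset.sum_add_distrib]
  have e2 : ∑ v ∈ Sᶜ, deg G v = ∑ v ∈ Sᶜ, degIn G S v + ∑ v ∈ Sᶜ, degIn G Sᶜ v := by
    rw [← Finset.sum_add_distrib]
    exact Finset.sum_congr rfl fun v _ => deg_eq_add S v
  rw [e2, sum_degIn_comm S Sᶜ]
  ring

theorem bddAbove_indepSet_card (H : SimpleGraph V) :
    BddAbove {n | ∃ s : Finset V, IsIndepSet H s ∧ s.card = n} :=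
  ⟨Fintype.card V, by rintro _ ⟨s, _, rfl⟩; exact Finset.card_le_univ s⟩

theorem IsIndepSet.card_le_indepNum {s : Finset V} (h : IsIndepSet G s) : s.card ≤ indepNum G :=
  le_csSup (bddAbove_indepSet_card G) ⟨s, h, rfl⟩

theorem exists_isIndepSet_card_eq_indepNum (H : SimpleGraph V) :
    ∃ s : Finset V, IsIndepSet H s ∧ s.card = indepNum H :=
  Nat.sSup_mem (s := {n | ∃ s : Finset V, IsIndepSet H s ∧ s.card = n})
    ⟨0, ∅, by simp [IsIndepSet], rfl⟩ (bddAbove_indepSet_card H)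

theorem IsExtension.indepNum_induce_add_card_le {K : Finset V} (h : IsExtension G S K) :
    indepNum (G.induce ((S : Set V)ᶜ)) + K.card ≤ indepNum G := by
  obtain ⟨s, hs, hc⟩ := exists_isIndepSet_card_eq_indepNum (G.induce ((S : Set V)ᶜ))
  have hout : ∀ x ∈ s.map (Function.Embedding.subtype _), x ∉ S := by
    intro x hx hxS
    obtain ⟨y, -, rfl⟩ := Finset.mem_map.1 hx
    exact y.2 hxS
  have hd : Disjoint (s.map (Function.Embedding.subtype _)) K :=
    Finset.disjoint_left.2 fun x hx hxK => hout x hx (h.subset hxK)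
  rw [← hc, ← Finset.card_map (Function.Embedding.subtype _), ← Finset.card_union_of_disjoint hd]
  refine IsIndepSet.card_le_indepNum fun v hv w hw hvw => ?_
  rcases Finset.mem_union.1 hv with hv | hv <;> rcases Finset.mem_union.1 hw with hw | hw
  · obtain ⟨v', hv', rfl⟩ := Finset.mem_map.1 hv
    obtain ⟨w', hw', rfl⟩ := Finset.mem_map.1 hw
    exact hs v' hv' w' hw' hvw
  · exact hout v hv (h.closed w hw v hvw.symm)
  · exact hout w hw (h.closed v hv w hvw)
  · exact h.indep v hv w hw hvw

theorem isCopy_of_iso {W : Type} {H : SimpleGraph W} {n : ℕ} {F : SimpleGraph (Fin n)}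
    (ψ : H ↪g G) {s : Set W} (e : H.induce s ≃g F) :
    IsCopy F G (Finset.univ.filter (· ∈ ψ '' s)) := by
  refine ⟨(e.symm.toEmbedding.trans (SimpleGraph.Embedding.induce s)).trans ψ, ?_⟩
  ext x
  simp only [Finset.mem_filter, Finset.mem_univ, true_and, Finset.mem_map, Set.mem_image]
  constructor
  · rintro ⟨w, hw, rfl⟩
    exact ⟨e ⟨w, hw⟩, by simp⟩
  · rintro ⟨i, rfl⟩
    exact ⟨(e.symm i : W), (e.symm i).2, rfl⟩

theorem exists_iso_of_isCopy {W : Type} {H : SimpleGraph W} {n : ℕ} {F : SimpleGraph (Fin n)}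
    [NeZero n] (hF : F.Preconnected) (ψ : H ↪g G) (hψ : ∀ x, x ∈ Set.range ψ ↔ x ∉ S)
    (hd : Disjoint A S) (hA : IsCopy F G A)
    (hclosed : ∀ x ∈ A, ∀ y, G.Adj x y → y ∉ S → y ∈ A) :
    ∃ c : H.ConnectedComponent, Nonempty (H.induce c.supp ≃g F) ∧
      Finset.univ.filter (· ∈ ψ '' c.supp) = A := by
  obtain ⟨φ, rfl⟩ := hA
  have hw : ∀ i, ∃ w, ψ w = φ i := fun i =>
    (hψ _).2 (Finset.disjoint_left.1 hd (Finset.mem_map_of_mem _ (Finset.mem_univ i)))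
  choose w hw using hw
  let χ : F ↪g H :=
    ⟨⟨w, fun i j h => φ.injective (by rw [← hw, ← hw, h])⟩, fun {i j} => by
      rw [← φ.map_adj_iff, ← hw i, ← hw j, ψ.map_adj_iff]; rfl⟩
  have hχ : ∀ i, ψ (χ i) = φ i := hw
  have hs := supp_eq_range_of_closed hF χ 0 (by
    intro j y hy
    have hadj : G.Adj (φ j) (ψ y) := by rw [← hχ]; exact ψ.map_adj_iff.2 hy
    have := hclosed (φ j) (Finset.mem_map_of_mem _ (Finset.mem_univ j)) (ψ y) hadj
      ((hψ _).1 ⟨y, rfl⟩)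
    obtain ⟨i, -, hi⟩ := Finset.mem_map.1 this
    exact ⟨i, ψ.injective ((hχ i).trans hi)⟩)
  refine ⟨H.connectedComponentMk (χ 0), ?_, ?_⟩
  · rw [hs]
    exact ⟨χ.isoInduceRange.symm⟩
  · rw [hs]
    ext x
    simp only [Finset.mem_filter, Finset.mem_univ, true_and, Finset.mem_map, Set.mem_image,
      Set.mem_range]
    constructor
    · rintro ⟨_, ⟨i, rfl⟩, rfl⟩
      exact ⟨i, (hχ i).symm⟩
    · rintro ⟨i, rfl⟩
      exact ⟨_, ⟨i, rfl⟩, hχ i⟩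

/-- Difficult components of an induced subgraph `G - S` correspond to `difficultSets G S`. -/
theorem lambda_eq_card_difficultSets {W : Type} {H : SimpleGraph W} (ψ : H ↪g G)
    (hψ : ∀ x, x ∈ Set.range ψ ↔ x ∉ S) : lambda H = (difficultSets G S).card := by
  have hmem : ∀ c : H.ConnectedComponent, IsDifficult H c →
      Finset.univ.filter (· ∈ ψ '' c.supp) ∈ difficultSets G S := by
    intro c hc
    rw [difficultSets, Finset.mem_filter]
    refine ⟨Finset.mem_univ _, ?_, ?_, ?_⟩
    · rw [Finset.disjoint_left]
      intro x hx
      obtain ⟨w, -, rfl⟩ := (Finset.mem_filter.1 hx).2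
      exact (hψ _).1 ⟨w, rfl⟩
    · rcases hc with ⟨⟨e⟩⟩ | ⟨⟨e⟩⟩
      · exact Or.inl (isCopy_of_iso ψ e)
      · exact Or.inr (isCopy_of_iso ψ e)
    · intro x hx y hxy hy
      obtain ⟨w, hw, rfl⟩ := (Finset.mem_filter.1 hx).2
      obtain ⟨z, rfl⟩ := (hψ y).2 hy
      exact Finset.mem_filter.2 ⟨Finset.mem_univ _, z,
        c.mem_supp_of_adj_mem_supp hw (ψ.map_adj_iff.1 hxy), rfl⟩
  rw [lambda, ← Nat.card_eq_finsetCard]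
  refine Nat.card_eq_of_bijective (fun c => ⟨_, hmem c.1 c.2⟩) ⟨?_, ?_⟩
  · rintro ⟨c, hc⟩ ⟨c', hc'⟩ h
    simp only [Subtype.mk.injEq] at h ⊢
    apply SimpleGraph.ConnectedComponent.supp_injective
    apply ψ.injective.image_injective
    ext x
    simpa using Finset.ext_iff.1 h x
  · rintro ⟨A, hA⟩
    obtain ⟨hd, hcopy, hcl⟩ := (Finset.mem_filter.1 hA).2
    rcases hcopy with hcopy | hcopy
    · obtain ⟨c, hc, h⟩ := exists_iso_of_isCopy SimpleGraph.preconnected_top ψ hψ hd hcopy hcl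
      exact ⟨⟨c, Or.inl hc⟩, Subtype.ext h⟩
    · obtain ⟨c, hc, h⟩ := exists_iso_of_isCopy chainGraph_preconnected ψ hψ hd hcopy hcl
      exact ⟨⟨c, Or.inr hc⟩, Subtype.ext h⟩

/-- The gain inequality: removing `S` from a minimum counterexample cannot be profitable. -/
theorem IsMinCounterexample.gain_lt {a b : ℝ} (hG : IsMinCounterexample a b G) {K : Finset V}
    (hS : S.Nonempty) (h : IsExtension G S K) :
    a * S.card + b * (twiceIncident G S / 2) + b * (difficultSets G ∅).card <
      S.card - K.card + b * (difficultSets G S).card := by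
  have hcard : Nat.card ((S : Set V)ᶜ : Set V) + S.card = Nat.card V := by
    rw [Nat.card_coe_set_eq, ← Set.ncard_coe_finset, add_comm, Set.ncard_add_ncard_compl]
  have hpos := hS.card_pos
  have h1 := hG.minimal _ (G.induce ((S : Set V)ᶜ)) (by omega)
    fun h => hG.noTriangleAdjC4 (h.of_embedding (SimpleGraph.Embedding.induce _))
  have h2 := hG.counterexample
  rw [lambda_eq_card_difficultSets (S := S) (SimpleGraph.Embedding.induce _) (by
    intro x; simp [SimpleGraph.Embedding.induce])] at h1
  rw [lambda_eq_card_difficultSets (S := ∅) (SimpleGraph.Embedding.refl) (by simp)] at h2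
  have h3 : (indepNum (G.induce ((S : Set V)ᶜ)) : ℝ) + K.card ≤ indepNum G := by
    exact_mod_cast h.indepNum_induce_add_card_le
  have h4 : 2 * (numEdges G : ℝ) =
      2 * numEdges (G.induce ((S : Set V)ᶜ)) + twiceIncident G S := by
    exact_mod_cast two_mul_numEdges_induce (G := G) S
  rw [← hcard] at h2
  push_cast at h2
  have h5 : (numEdges G : ℝ) =
      numEdges (G.induce ((S : Set V)ᶜ)) + twiceIncident G S / 2 := by linarith
  rw [h5] at h2
  nlinarith

theorem mem_difficultSets : A ∈ difficultSets G S ↔ IsDifficultMod G S A := by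
  simp [difficultSets]

theorem IsDifficultMod.boundaryIn_nonempty (hG : difficultSets G ∅ = ∅)
    (hA : IsDifficultMod G S A) : (boundaryIn G S A).Nonempty := by
  by_contra h
  rw [Finset.not_nonempty_iff_eq_empty] at h
  have : A ∈ difficultSets G ∅ := by
    rw [mem_difficultSets]
    refine ⟨by simp, hA.copy, fun x hx y hxy _ => hA.closed x hx y hxy fun hy => ?_⟩
    have : x ∈ boundaryIn G S A := mem_boundaryIn.2 ⟨hx, y, hy, hxy⟩
    simp [h] at this
  simp [hG] at this

theorem mul_card_difficultSets_le_leaving {t : ℕ}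
    (h : ∀ A, IsDifficultMod G S A → t ≤ (boundaryIn G S A).card) :
    t * (difficultSets G S).card ≤ leaving G S := by
  calc t * (difficultSets G S).card
      ≤ ∑ A ∈ difficultSets G S, (boundaryIn G S A).card := by
        rw [mul_comm, ← smul_eq_mul]
        exact Finset.card_nsmul_le_sum _ _ _ fun A hA => h A (mem_difficultSets.1 hA)
    _ = ((difficultSets G S).biUnion (boundaryIn G S)).card := by
        rw [Finset.card_biUnion]
        intro A hA B hB hne
        exact ((mem_difficultSets.1 hA).disjoint_of_ne (mem_difficultSets.1 hB) hne).mono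
          (Finset.filter_subset _ _) (Finset.filter_subset _ _)
    _ ≤ (S.biUnion fun s => Sᶜ.filter (G.Adj s)).card := by
        refine Finset.card_le_card fun x hx => ?_
        obtain ⟨A, hA, hx⟩ := Finset.mem_biUnion.1 hx
        obtain ⟨hxA, s, hs, hxs⟩ := mem_boundaryIn.1 hx
        refine Finset.mem_biUnion.2 ⟨s, hs, Finset.mem_filter.2 ⟨?_, hxs.symm⟩⟩
        exact Finset.mem_compl.2 (Finset.disjoint_left.1 (mem_difficultSets.1 hA).disjoint hxA)
    _ ≤ leaving G S := Finset.card_biUnion_le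

theorem card_difficultSets_le_leaving (hG : difficultSets G ∅ = ∅) (S : Finset V) :
    (difficultSets G S).card ≤ leaving G S := by
  rw [← one_mul (difficultSets G S).card]
  exact mul_card_difficultSets_le_leaving fun A hA => (hA.boundaryIn_nonempty hG).card_pos

theorem IsDifficultMod.card_union_add_one_le (hA : IsDifficultMod G S A) :
    (difficultSets G (S ∪ A)).card + 1 ≤ (difficultSets G S).card := by
  have hAmem : A ∉ difficultSets G (S ∪ A) := by
    intro h
    have := (mem_difficultSets.1 h).disjoint
    obtain ⟨x, hx⟩ := hA.nonempty
    exact Finset.disjoint_left.1 this hx (Finset.mem_union_right _ hx)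
  rw [← Finset.card_insert_of_notMem hAmem]
  refine Finset.card_le_card fun B hB => ?_
  rcases Finset.mem_insert.1 hB with rfl | hB
  · exact mem_difficultSets.2 hA
  · have hB := mem_difficultSets.1 hB
    have hd := Finset.disjoint_union_right.1 hB.disjoint
    refine mem_difficultSets.2 ⟨hd.1, hB.copy, fun x hx y hxy hy => ?_⟩
    refine hB.closed x hx y hxy fun hy' => ?_
    rcases Finset.mem_union.1 hy' with hy' | hy'
    · exact hy hy'
    · exact Finset.disjoint_left.1 hd.2 hx
        (hA.closed y hy' x hxy.symm (Finset.disjoint_left.1 hd.1 hx))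

/-- Enlarging `S` by a difficult component of `G - S`. -/
theorem IsDifficultMod.absorb {n : ℕ} {F : SimpleGraph (Fin n)} [DecidableRel F.Adj]
    {J : Finset (Fin n)} (hJ : ∀ i ∈ J, ∀ j ∈ J, ¬ F.Adj i j) (hA : IsDifficultMod G S A)
    (hF : IsCopy F G A) {K : Finset V} (hK : IsExtension G S K) :
    ∃ K', IsExtension G (S ∪ A) K' ∧ K'.card = K.card + J.card ∧
      (S ∪ A).card = S.card + n ∧
      twiceIncident G S + ∑ i, (Finset.univ.filter (F.Adj i)).card ≤ twiceIncident G (S ∪ A) ∧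
      (difficultSets G (S ∪ A)).card + 1 ≤ (difficultSets G S).card := by
  have h1 := twiceIncident_union (G := G) hA.disjoint
  have h2 := hA.card_union_add_one_le
  obtain ⟨φ, rfl⟩ := hF
  have hsub : J.map φ.toEmbedding ⊆ Finset.univ.map φ.toEmbedding :=
    Finset.map_subset_map.2 (Finset.subset_univ J)
  refine ⟨K ∪ J.map φ.toEmbedding, hK.union hA hsub ?_, ?_, ?_, ?_, h2⟩
  · intro x hx y hy hxy
    obtain ⟨i, hi, rfl⟩ := Finset.mem_map.1 hx
    obtain ⟨j, hj, rfl⟩ := Finset.mem_map.1 hy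
    exact hJ i hi j hj (φ.map_adj_iff.1 hxy)
  · rw [Finset.card_union_of_disjoint, Finset.card_map]
    exact (hA.disjoint.mono hsub hK.subset).symm
  · rw [Finset.card_union_of_disjoint hA.disjoint.symm, Finset.card_map, Finset.card_univ,
      Fintype.card_fin]
  · refine le_trans (le_of_eq ?_) h1
    rw [Finset.sum_map]
    congr 1
    exact Finset.sum_congr rfl fun i _ => (degIn_map φ i).symm

theorem IsDifficultMod.absorb_triangle (hA : IsDifficultMod G S A)
    (hF : IsCopy (⊤ : SimpleGraph (Fin 3)) G A) {K : Finset V} (hK : IsExtension G S K) :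
    ∃ K', IsExtension G (S ∪ A) K' ∧ K'.card = K.card + 1 ∧ (S ∪ A).card = S.card + 3 ∧
      twiceIncident G S + 6 ≤ twiceIncident G (S ∪ A) ∧
      (difficultSets G (S ∪ A)).card + 1 ≤ (difficultSets G S).card :=
  hA.absorb (J := {0}) (by decide) hF hK

theorem IsDifficultMod.absorb_chain (hA : IsDifficultMod G S A)
    (hF : IsCopy chainGraph G A) {K : Finset V} (hK : IsExtension G S K) :
    ∃ K', IsExtension G (S ∪ A) K' ∧ K'.card = K.card + 2 ∧ (S ∪ A).card = S.card + 6 ∧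
      twiceIncident G S + 14 ≤ twiceIncident G (S ∪ A) ∧
      (difficultSets G (S ∪ A)).card + 1 ≤ (difficultSets G S).card :=
  hA.absorb (J := {0, 4}) (by decide) hF hK

theorem IsMinCounterexample.gain_lt_of_le {a b : ℝ} (hG : IsMinCounterexample a b G)
    (hb : 0 ≤ b) {K : Finset V} (hS : S.Nonempty) (h : IsExtension G S K) {c k t : ℕ}
    (hc : S.card = c) (hk : K.card = k)
    (ht : 2 * (t + (difficultSets G S).card) ≤
      twiceIncident G S + 2 * (difficultSets G ∅).card) :
    a * c + b * t < c - k := by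
  have h1 := hG.gain_lt hS h
  rw [hc, hk] at h1
  have h2 : 2 * ((t : ℝ) + (difficultSets G S).card) ≤
      twiceIncident G S + 2 * (difficultSets G ∅).card := by exact_mod_cast ht
  nlinarith

theorem IsMinCounterexample.difficultSets_empty {a b : ℝ} (hG : IsMinCounterexample a b G)
    (hb : 0 ≤ b) (h : 2 ≤ 3 * a + 4 * b) : difficultSets G ∅ = ∅ := by
  rw [Finset.eq_empty_iff_forall_notMem]
  intro A hA
  have hA := mem_difficultSets.1 hA
  have h0 : IsExtension G ∅ ∅ := ⟨by simp, by simp [IsIndepSet], by simp⟩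
  rcases hA.copy with hF | hF
  · obtain ⟨K, hK, hk, hc, he, hd⟩ := hA.absorb_triangle hF h0
    have := hG.gain_lt_of_le hb (Finset.card_pos.1 (by omega)) hK hc hk (t := 4) (by omega)
    norm_num at this
    linarith
  · obtain ⟨K, hK, hk, hc, he, hd⟩ := hA.absorb_chain hF h0
    have := hG.gain_lt_of_le hb (Finset.card_pos.1 (by omega)) hK hc hk (t := 8) (by omega)
    norm_num at this
    linarith

theorem deg_eq_card {v : V} {s : Finset V} (h : ∀ z, G.Adj v z ↔ z ∈ s) :
    deg G v = s.card := by
  rw [deg_eq_degIn_univ, degIn]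
  congr 1
  ext z
  simp [h]

theorem exists_neighbors_eq (v : V) :
    ∃ s : Finset V, s.card = deg G v ∧ ∀ z, G.Adj v z ↔ z ∈ s :=
  ⟨Finset.univ.filter (G.Adj v), (deg_eq_card (by simp)).symm, by simp⟩

theorem leaving_triangle {p q r : V} (hpq : G.Adj p q) (hqr : G.Adj q r) (hpr : G.Adj p r) :
    leaving G {p, q, r} + 6 = deg G p + deg G q + deg G r := by
  have h := deg_sum_eq_leaving_add (G := G) {p, q, r}
  have h1 : p ∉ ({q, r} : Finset V) := by simp [hpq.ne, hpr.ne]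
  have h2 : q ∉ ({r} : Finset V) := by simp [hqr.ne]
  simp only [degIn_eq_sum, Finset.sum_insert h1, Finset.sum_insert h2, Finset.sum_singleton,
    hpq, hqr, hpr, hpq.symm, hqr.symm, hpr.symm, G.irrefl, if_true, if_false] at h
  omega

theorem twiceIncident_triangle {p q r : V} (hpq : G.Adj p q) (hqr : G.Adj q r)
    (hpr : G.Adj p r) : twiceIncident G {p, q, r} = 2 * leaving G {p, q, r} + 6 := by
  have h := twiceIncident_eq (G := G) {p, q, r}
  have h1 : p ∉ ({q, r} : Finset V) := by simp [hpq.ne, hpr.ne]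
  have h2 : q ∉ ({r} : Finset V) := by simp [hqr.ne]
  rw [Finset.sum_insert h1, Finset.sum_insert h2, Finset.sum_singleton] at h
  have := leaving_triangle hpq hqr hpr
  omega

/-- A difficult triangle attached to a pendant triangle would form a 2-chain component. -/
theorem IsDifficultMod.false_of_pendant_triangle {p q r w : V}
    (hD : IsDifficultMod G {p, q, r} A) (h0 : difficultSets G ∅ = ∅)
    (hF : IsCopy (⊤ : SimpleGraph (Fin 3)) G A)
    (hp : ∀ z, G.Adj p z ↔ z ∈ ({q, r} : Finset V))
    (hq : ∀ z, G.Adj q z ↔ z ∈ ({p, r} : Finset V))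
    (hr : ∀ z, G.Adj r z ↔ z ∈ ({p, q, w} : Finset V)) : False := by
  have hpq : G.Adj p q := (hp q).2 (by simp)
  have hpr : G.Adj p r := (hp r).2 (by simp)
  have hqr : G.Adj q r := (hq r).2 (by simp)
  have hrw : G.Adj r w := (hr w).2 (by simp)
  have hS : ∀ u ∈ ({p, q, r} : Finset V), ∀ y, G.Adj u y → y ∈ ({p, q, r} : Finset V) ∨ y = w := by
    intro u hu y huy
    simp only [Finset.mem_insert, Finset.mem_singleton] at hu
    rcases hu with rfl | rfl | rfl
    · have := (hp y).1 huy
      clear * - this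
      grind
    · have := (hq y).1 huy
      clear * - this
      grind
    · have := (hr y).1 huy
      clear * - this
      grind
  obtain ⟨x, hx⟩ := hD.boundaryIn_nonempty h0
  obtain ⟨hxA, y, hy, hxy⟩ := mem_boundaryIn.1 hx
  have hxw : x = w :=
    (hS y hy x hxy.symm).resolve_left (Finset.disjoint_left.1 hD.disjoint hxA)
  subst hxw
  obtain ⟨s, t, rfl, hws, hwt, hst⟩ := hF.exists_triangle hxA
  have hchain := isCopy_chain hpq hpr hqr hrw hws hwt hst
    (fun z hz => by simpa using (hp z).1 hz) (fun z hz => by simpa using (hq z).1 hz)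
    (fun z hz => by simpa using (hr z).1 hz) hD.disjoint
  have : {p, q, r} ∪ {x, s, t} ∈ difficultSets G ∅ := by
    refine mem_difficultSets.2 ⟨by simp, Or.inr hchain, fun u hu y huy _ => ?_⟩
    rw [Finset.mem_union] at hu ⊢
    rcases hu with hu | hu
    · rcases hS u hu y huy with h | rfl
      · exact Or.inl h
      · exact Or.inr (by simp)
    · by_cases hy : y ∈ ({p, q, r} : Finset V)
      · exact Or.inl hy
      · exact Or.inr (hD.closed u hu y huy hy)
  simp [h0] at this

/-- There is no triangle attached to the rest of `G` by a single edge. -/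
theorem IsMinCounterexample.no_pendant_triangle {a b : ℝ} (hG : IsMinCounterexample a b G)
    (hb : 0 ≤ b) (h2 : 2 ≤ 3 * a + 4 * b) (h3 : 6 ≤ 9 * a + 11 * b) {p q r w : V}
    (hp : ∀ z, G.Adj p z ↔ z ∈ ({q, r} : Finset V))
    (hq : ∀ z, G.Adj q z ↔ z ∈ ({p, r} : Finset V))
    (hr : ∀ z, G.Adj r z ↔ z ∈ ({p, q, w} : Finset V)) (hwp : w ≠ p) (hwq : w ≠ q) : False := by
  have h0 := hG.difficultSets_empty hb h2
  have hpq : G.Adj p q := (hp q).2 (by simp)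
  have hpr : G.Adj p r := (hp r).2 (by simp)
  have hqr : G.Adj q r := (hq r).2 (by simp)
  have hrw : G.Adj r w := (hr w).2 (by simp)
  have hl := leaving_triangle hpq hqr hpr
  have he := twiceIncident_triangle hpq hqr hpr
  rw [deg_eq_card hp, deg_eq_card hq, deg_eq_card hr, Finset.card_pair hqr.ne,
    Finset.card_pair hpr.ne, Finset.card_eq_three.2 ⟨p, q, w, hpq.ne, hwp.symm, hwq.symm, rfl⟩]
    at hl
  have hd := card_difficultSets_le_leaving h0 {p, q, r}
  have hK : IsExtension G {p, q, r} {p} := isExtension_singleton (by simp) fun y hy => by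
    have := (hp y).1 hy
    simp only [Finset.mem_insert, Finset.mem_singleton] at this ⊢
    tauto
  have hc : ({p, q, r} : Finset V).card = 3 :=
    Finset.card_eq_three.2 ⟨p, q, r, hpq.ne, hpr.ne, hqr.ne, rfl⟩
  rcases Finset.eq_empty_or_nonempty (difficultSets G {p, q, r}) with hd0 | ⟨D, hD⟩
  · have := hG.gain_lt_of_le hb ⟨p, by simp⟩ hK hc (Finset.card_singleton p) (t := 4)
      (by rw [hd0, Finset.card_empty]; omega)
    norm_num at this
    linarith
  have hD := mem_difficultSets.1 hD
  rcases hD.copy with hF | hF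
  · exact hD.false_of_pendant_triangle h0 hF hp hq hr
  · obtain ⟨K, hK', hk, hc', he', hd'⟩ := hD.absorb_chain hF hK
    rw [Finset.card_singleton] at hk
    rw [hc] at hc'
    have := hG.gain_lt_of_le hb (Finset.card_pos.1 (by omega)) hK' hc' hk (t := 11) (by omega)
    norm_num at this
    linarith

theorem IsMinCounterexample.two_le_deg {a b : ℝ} (hG : IsMinCounterexample a b G)
    (ha : 0 < a) (hb : 0 ≤ b) (h1 : 1 ≤ 2 * a + b) (h2 : 2 ≤ 3 * a + 4 * b) (v : V) :
    2 ≤ deg G v := by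
  have h0 := hG.difficultSets_empty hb h2
  by_contra! hlt
  obtain ⟨N, hN, hv⟩ := exists_neighbors_eq (G := G) v
  interval_cases hdv : deg G v
  · rw [Finset.card_eq_zero] at hN
    subst hN
    have hl := deg_sum_eq_leaving_add (G := G) {v}
    have hd := card_difficultSets_le_leaving h0 {v}
    rw [Finset.sum_singleton, hdv] at hl
    have := hG.gain_lt_of_le hb ⟨v, by simp⟩
      (isExtension_singleton (by simp) fun y hy => by simpa using (hv y).1 hy)
      (Finset.card_singleton v) (Finset.card_singleton v) (t := 0) (by omega)
    norm_num at this
    linarith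
  · obtain ⟨u, rfl⟩ := Finset.card_eq_one.1 hN
    have huv : G.Adj v u := (hv u).2 (by simp)
    have hl := deg_sum_eq_leaving_add (G := G) {v, u}
    have he := twiceIncident_eq (G := G) {v, u}
    have hd := card_difficultSets_le_leaving h0 {v, u}
    simp only [degIn_eq_sum, Finset.sum_pair huv.ne, huv, huv.symm, G.irrefl, if_true,
      if_false] at hl
    rw [Finset.sum_pair huv.ne] at he
    have := hG.gain_lt_of_le hb ⟨v, by simp⟩
      (isExtension_singleton (S := {v, u}) (v := v) (by simp) fun y hy => by
        have := (hv y).1 hy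
        simp_all)
      (Finset.card_pair huv.ne) (Finset.card_singleton v) (t := 1) (by omega)
    norm_num at this
    linarith

/-- One half of a chain is a pendant triangle unless one of its vertices is on the boundary. -/
theorem IsMinCounterexample.exists_mem_boundaryIn_chain {a b : ℝ}
    (hG : IsMinCounterexample a b G) (hb : 0 ≤ b) (h2 : 2 ≤ 3 * a + 4 * b)
    (h3 : 6 ≤ 9 * a + 11 * b) {φ : chainGraph ↪g G}
    (hA : IsDifficultMod G S (Finset.univ.map φ.toEmbedding)) {i j k l : Fin 6}
    (hi : ∀ m, chainGraph.Adj i m ↔ m = j ∨ m = k) (hj : ∀ m, chainGraph.Adj j m ↔ m = i ∨ m = k)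
    (hk : ∀ m, chainGraph.Adj k m ↔ m = i ∨ m = j ∨ m = l) (hli : l ≠ i) (hlj : l ≠ j) :
    ∃ m, (m = i ∨ m = j ∨ m = k) ∧ φ m ∈ boundaryIn G S (Finset.univ.map φ.toEmbedding) := by
  by_contra! h
  have e1 := hA.adj_iff_of_notMem_boundaryIn (h i (by simp))
  have e2 := hA.adj_iff_of_notMem_boundaryIn (h j (by simp))
  have e3 := hA.adj_iff_of_notMem_boundaryIn (h k (by simp))
  refine hG.no_pendant_triangle hb h2 h3 (p := φ i) (q := φ j) (r := φ k) (w := φ l) ?_ ?_ ?_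
    (φ.injective.ne hli) (φ.injective.ne hlj)
  · intro z
    rw [e1]
    simp [hi, or_and_right, exists_or]
  · intro z
    rw [e2]
    simp [hj, or_and_right, exists_or]
  · intro z
    rw [e3]
    simp [hk, or_and_right, exists_or]

/-- A difficult triangle of `G - {v, x, y}` has more than one boundary vertex, where `v, x, y`
is a triangle and `v` has degree two. -/
theorem IsMinCounterexample.false_of_boundaryIn_subset_singleton {a b : ℝ}
    (hG : IsMinCounterexample a b G) (hb : 0 ≤ b) (h2 : 2 ≤ 3 * a + 4 * b)
    (h3 : 6 ≤ 9 * a + 11 * b) {v x y w : V} (hv : ∀ z, G.Adj v z ↔ z ∈ ({x, y} : Finset V))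
    (hxy : G.Adj x y) (hA : IsDifficultMod G {v, x, y} A)
    (hF : IsCopy (⊤ : SimpleGraph (Fin 3)) G A) (hw : w ∈ boundaryIn G {v, x, y} A)
    (huniq : ∀ z ∈ boundaryIn G {v, x, y} A, z = w) : False := by
  have hvx : G.Adj v x := (hv x).2 (by simp)
  have hvy : G.Adj v y := (hv y).2 (by simp)
  obtain ⟨hwA, u, hu, hwu⟩ := mem_boundaryIn.1 hw
  obtain ⟨s, t, rfl, hws, hwt, hst⟩ := hF.exists_triangle hwA
  have hnot : ∀ z ∈ ({w, s, t} : Finset V), z ∉ ({v, x, y} : Finset V) := fun z hz =>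
    Finset.disjoint_left.1 hA.disjoint hz
  have hw1 := hnot w (by simp)
  have hus : u ≠ s := fun h => hnot s (by simp) (h ▸ hu)
  have hut : u ≠ t := fun h => hnot t (by simp) (h ▸ hu)
  have hclosed : ∀ z ∈ ({w, s, t} : Finset V), z ≠ w → ∀ m, G.Adj z m →
      m ∈ ({w, s, t} : Finset V) := fun z hz hzw m hm =>
    hA.closed z hz m hm fun hmS => hzw (huniq z (mem_boundaryIn.2 ⟨hz, m, hmS, hm⟩))
  have hwv : ¬ G.Adj w v := fun h => by
    have := (hv w).1 h.symm
    exact hw1 (Finset.mem_insert_of_mem this)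
  have hwxy : ¬ (G.Adj w x ∧ G.Adj w y) := fun h => by
    have := eq_of_adjacent_triangles hG.noTriangleAdjC4 hxy hvy.symm hvx h.1.symm h.2.symm
    simp [this] at hw1
  have hwu' : ∀ m ∈ ({v, x, y} : Finset V), G.Adj w m → m = u := by
    intro m hm h
    simp only [Finset.mem_insert, Finset.mem_singleton] at hm hu
    clear * - hm hu h hwu hwv hwxy
    grind
  refine hG.no_pendant_triangle hb h2 h3 (p := s) (q := t) (r := w) (w := u) ?_ ?_ ?_ hus hut
  · intro m
    constructor
    · intro h
      have h1 := hclosed s (by simp) hws.ne.symm m h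
      have h2 := h.ne
      clear * - h1 h2
      grind
    · intro h
      rcases Finset.mem_insert.1 h with rfl | h
      · exact hst
      · exact Finset.mem_singleton.1 h ▸ hws.symm
  · intro m
    constructor
    · intro h
      have h1 := hclosed t (by simp) hwt.ne.symm m h
      have h2 := h.ne
      clear * - h1 h2
      grind
    · intro h
      rcases Finset.mem_insert.1 h with rfl | h
      · exact hst.symm
      · exact Finset.mem_singleton.1 h ▸ hwt.symm
  · intro m
    constructor
    · intro h
      by_cases hm : m ∈ ({v, x, y} : Finset V)
      · simp [hwu' m hm h]
      · have h1 := hA.closed w hwA m h hm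
        have h2 := h.ne
        clear * - h1 h2
        grind
    · intro h
      simp only [Finset.mem_insert, Finset.mem_singleton] at h
      rcases h with rfl | rfl | rfl
      · exact hws
      · exact hwt
      · exact hwu

/-- A vertex of degree two is in no triangle. -/
theorem IsMinCounterexample.deg_ne_two_of_triangle {a b : ℝ} (hG : IsMinCounterexample a b G)
    (hb : 0 ≤ b) (h2 : 2 ≤ 3 * a + 4 * b) (h3 : 6 ≤ 9 * a + 11 * b) {v x y : V}
    (hv : ∀ z, G.Adj v z ↔ z ∈ ({x, y} : Finset V)) (hxy : G.Adj x y) : False := by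
  have h0 := hG.difficultSets_empty hb h2
  have hvx : G.Adj v x := (hv x).2 (by simp)
  have hvy : G.Adj v y := (hv y).2 (by simp)
  have he := twiceIncident_triangle hvx hxy hvy
  have hd : 2 * (difficultSets G {v, x, y}).card ≤ leaving G {v, x, y} := by
    refine mul_card_difficultSets_le_leaving fun A hA => ?_
    by_contra! hlt
    obtain ⟨w, hw⟩ := hA.boundaryIn_nonempty h0
    have huniq : ∀ z ∈ boundaryIn G {v, x, y} A, z = w := fun z hz =>
      Finset.card_le_one.1 (Nat.lt_succ_iff.1 hlt) z hz w hw
    rcases hA.copy with hF | ⟨φ, rfl⟩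
    · exact hG.false_of_boundaryIn_subset_singleton hb h2 h3 hv hxy hA hF hw huniq
    · obtain ⟨m, hm, hmb⟩ := hG.exists_mem_boundaryIn_chain hb h2 h3 hA (i := 0) (j := 1)
        (k := 2) (l := 3) (by decide) (by decide) (by decide) (by decide) (by decide)
      obtain ⟨m', hm', hmb'⟩ := hG.exists_mem_boundaryIn_chain hb h2 h3 hA (i := 4) (j := 5)
        (k := 3) (l := 2) (by decide) (by decide) (by decide) (by decide) (by decide)
      have : m = m' := φ.injective ((huniq _ hmb).trans (huniq _ hmb').symm)
      revert hm hm' this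
      clear hmb hmb'
      revert m m'
      decide
  rcases Nat.eq_zero_or_pos (leaving G {v, x, y}) with hl | hl
  · have : {v, x, y} ∈ difficultSets G ∅ := by
      refine mem_difficultSets.2 ⟨by simp, Or.inl (isCopy_triangle hvx hxy hvy), ?_⟩
      intro z hz m hm _
      by_contra hmS
      rw [leaving, Finset.sum_eq_zero_iff] at hl
      have := hl z hz
      rw [degIn, Finset.card_eq_zero, Finset.filter_eq_empty_iff] at this
      exact this (Finset.mem_compl.2 hmS) hm
    simp [h0] at this
  · have := hG.gain_lt_of_le hb ⟨v, by simp⟩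
      (isExtension_singleton (S := {v, x, y}) (v := v) (by simp) fun z hz => by
        have := (hv z).1 hz
        simp only [Finset.mem_insert, Finset.mem_singleton] at this ⊢
        tauto)
      (Finset.card_eq_three.2 ⟨v, x, y, hvx.ne, hvy.ne, hxy.ne, rfl⟩)
      (Finset.card_singleton v) (t := 4) (by omega)
    norm_num at this
    linarith

/-- The boundary of a difficult component contains three vertices, two of them in a common
triangle of the component, provided that every triangle vertex has degree at least three. -/
theorem IsDifficultMod.boundaryIn_large (hA : IsDifficultMod G S A)
    (htri : ∀ p q r, G.Adj p q → G.Adj q r → G.Adj p r → 3 ≤ deg G p) :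
    3 ≤ (boundaryIn G S A).card ∧ ∃ p ∈ boundaryIn G S A, ∃ q ∈ boundaryIn G S A, ∃ r ∈ A,
      G.Adj p q ∧ G.Adj q r ∧ G.Adj p r := by
  rcases hA.copy with ⟨φ, rfl⟩ | ⟨φ, rfl⟩
  · have hne : ∀ i : Fin 3, i ≠ i + 1 ∧ i + 1 ≠ i + 2 ∧ i ≠ i + 2 := by decide
    have hb : ∀ i, φ i ∈ boundaryIn G S (Finset.univ.map φ.toEmbedding) := by
      intro i
      by_contra hi
      have hadj := hA.adj_iff_of_notMem_boundaryIn hi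
      have h1 := htri (φ i) (φ (i + 1)) (φ (i + 2)) (φ.map_adj_iff.2 (hne i).1)
        (φ.map_adj_iff.2 (hne i).2.1) (φ.map_adj_iff.2 (hne i).2.2)
      rw [deg_eq_card (s := (Finset.univ.filter
        ((⊤ : SimpleGraph (Fin 3)).Adj i)).map φ.toEmbedding) (by
          intro z; rw [hadj]; simp [eq_comm]), Finset.card_map] at h1
      revert h1
      clear hadj hi
      revert i
      decide
    refine ⟨?_, φ 0, hb 0, φ 1, hb 1, φ 2, by simp, ?_, ?_, ?_⟩
    · have : Finset.univ.map φ.toEmbedding ⊆ boundaryIn G S (Finset.univ.map φ.toEmbedding) := by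
        intro x hx
        obtain ⟨i, -, rfl⟩ := Finset.mem_map.1 hx
        exact hb i
      simpa using Finset.card_le_card this
    all_goals exact φ.map_adj_iff.2 (by decide)
  · have hb : ∀ i j k, chainGraph.Adj i j → chainGraph.Adj j k → chainGraph.Adj i k →
        (Finset.univ.filter (chainGraph.Adj i)).card = 2 →
        φ i ∈ boundaryIn G S (Finset.univ.map φ.toEmbedding) := by
      intro i j k hij hjk hik hcard
      by_contra hi
      have hadj := hA.adj_iff_of_notMem_boundaryIn hi
      have h1 := htri (φ i) (φ j) (φ k) (φ.map_adj_iff.2 hij)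
        (φ.map_adj_iff.2 hjk) (φ.map_adj_iff.2 hik)
      rw [deg_eq_card (s := (Finset.univ.filter (chainGraph.Adj i)).map φ.toEmbedding) (by
          intro z; rw [hadj]; simp [eq_comm]), Finset.card_map, hcard] at h1
      omega
    have b0 := hb 0 1 2 (by decide) (by decide) (by decide) (by decide)
    have b1 := hb 1 0 2 (by decide) (by decide) (by decide) (by decide)
    have b4 := hb 4 5 3 (by decide) (by decide) (by decide) (by decide)
    refine ⟨?_, φ 0, b0, φ 1, b1, φ 2, by simp, ?_, ?_, ?_⟩
    · have : ({0, 1, 4} : Finset (Fin 6)).map φ.toEmbedding ⊆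
          boundaryIn G S (Finset.univ.map φ.toEmbedding) := by
        intro x hx
        obtain ⟨i, hi, rfl⟩ := Finset.mem_map.1 hx
        simp only [Finset.mem_insert, Finset.mem_singleton] at hi
        rcases hi with rfl | rfl | rfl
        exacts [b0, b1, b4]
      simpa using Finset.card_le_card this
    all_goals exact φ.map_adj_iff.2 (by decide)

theorem three_mul_card_difficultSets_le_leaving
    (htri : ∀ p q r, G.Adj p q → G.Adj q r → G.Adj p r → 3 ≤ deg G p) (S : Finset V) :
    3 * (difficultSets G S).card ≤ leaving G S :=
  mul_card_difficultSets_le_leaving fun _ hA => (hA.boundaryIn_large htri).1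

theorem IsMinCounterexample.three_le_deg_of_triangle {a b : ℝ} (hG : IsMinCounterexample a b G)
    (ha : 0 < a) (hb : 0 ≤ b) (h1 : 1 ≤ 2 * a + b) (h2 : 2 ≤ 3 * a + 4 * b)
    (h3 : 6 ≤ 9 * a + 11 * b) {p q r : V} (hpq : G.Adj p q) (hqr : G.Adj q r)
    (hpr : G.Adj p r) : 3 ≤ deg G p := by
  by_contra! hlt
  have hp2 := hG.two_le_deg ha hb h1 h2 p
  obtain ⟨N, hN, hp⟩ := exists_neighbors_eq (G := G) p
  have hsub : {q, r} ⊆ N := by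
    intro z hz
    rcases Finset.mem_insert.1 hz with rfl | hz
    · exact (hp z).1 hpq
    · exact (hp z).1 (Finset.mem_singleton.1 hz ▸ hpr)
  have := Finset.eq_of_subset_of_card_le hsub (by rw [Finset.card_pair hqr.ne]; omega)
  subst this
  exact hG.deg_ne_two_of_triangle hb h2 h3 hp hqr

theorem IsMinCounterexample.three_le_deg {a b : ℝ} (hG : IsMinCounterexample a b G)
    (ha : 0 < a) (hb : 0 ≤ b) (h1 : 1 ≤ 2 * a + b) (h2 : 2 ≤ 3 * a + 4 * b)
    (h3 : 6 ≤ 9 * a + 11 * b) (v : V) : 3 ≤ deg G v := by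
  by_contra! hlt
  have hdeg := hG.two_le_deg ha hb h1 h2
  have hv2 : deg G v = 2 := le_antisymm (Nat.lt_succ_iff.1 hlt) (hdeg v)
  obtain ⟨N, hN, hv⟩ := exists_neighbors_eq (G := G) v
  obtain ⟨x, y, hne, rfl⟩ := Finset.card_eq_two.1 (hN.trans hv2)
  have hvx : G.Adj v x := (hv x).2 (by simp)
  have hvy : G.Adj v y := (hv y).2 (by simp)
  have hxy : ¬ G.Adj x y := hG.deg_ne_two_of_triangle hb h2 h3 hv
  have hyx : ¬ G.Adj y x := fun h => hxy h.symm
  have hl := deg_sum_eq_leaving_add (G := G) {v, x, y}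
  have he := twiceIncident_eq (G := G) {v, x, y}
  have hd := three_mul_card_difficultSets_le_leaving (G := G)
    (fun _ _ _ => hG.three_le_deg_of_triangle ha hb h1 h2 h3) {v, x, y}
  have m1 : v ∉ ({x, y} : Finset V) := by simp [hvx.ne, hvy.ne]
  have m2 : x ∉ ({y} : Finset V) := by simp [hne]
  simp only [degIn_eq_sum, Finset.sum_insert m1, Finset.sum_insert m2, Finset.sum_singleton,
    hvx, hvy, hxy, hyx, hvx.symm, hvy.symm, G.irrefl, if_true, if_false] at hl he
  have := hdeg x
  have := hdeg y
  have := hG.gain_lt_of_le hb ⟨v, by simp⟩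
    (isExtension_singleton (S := {v, x, y}) (v := v) (by simp) fun z hz =>
      Finset.mem_insert_of_mem ((hv z).1 hz))
    (Finset.card_eq_three.2 ⟨v, x, y, hvx.ne, hvy.ne, hne, rfl⟩)
    (Finset.card_singleton v) (t := 4) (by omega)
  norm_num at this
  linarith

theorem leaving_claw {v p q r : V} (hvp : G.Adj v p) (hvq : G.Adj v q) (hvr : G.Adj v r)
    (hpq : p ≠ q) (hpr : p ≠ r) (hqr : q ≠ r) (hnpr : ¬ G.Adj p r) (hnqr : ¬ G.Adj q r) :
    leaving G {v, p, q, r} + 6 + (if G.Adj p q then 2 else 0) =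
      deg G v + deg G p + deg G q + deg G r := by
  have hl := deg_sum_eq_leaving_add (G := G) {v, p, q, r}
  have m1 : v ∉ ({p, q, r} : Finset V) := by simp [hvp.ne, hvq.ne, hvr.ne]
  have m2 : p ∉ ({q, r} : Finset V) := by simp [hpq, hpr]
  have m3 : q ∉ ({r} : Finset V) := by simp [hqr]
  have hnrp : ¬ G.Adj r p := fun h => hnpr h.symm
  have hnrq : ¬ G.Adj r q := fun h => hnqr h.symm
  simp only [degIn_eq_sum, Finset.sum_insert m1, Finset.sum_insert m2, Finset.sum_insert m3,
    Finset.sum_singleton, hvp, hvq, hvr, hvp.symm, hvq.symm, hvr.symm, hnpr, hnqr, hnrp, hnrq,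
    G.adj_comm q p, G.irrefl, if_true, if_false] at hl
  split_ifs at hl ⊢ <;> omega

theorem twiceIncident_claw {v p q r : V} (hvp : G.Adj v p) (hvq : G.Adj v q) (hvr : G.Adj v r)
    (hpq : p ≠ q) (hpr : p ≠ r) (hqr : q ≠ r) :
    twiceIncident G {v, p, q, r} =
      deg G v + deg G p + deg G q + deg G r + leaving G {v, p, q, r} := by
  have m1 : v ∉ ({p, q, r} : Finset V) := by simp [hvp.ne, hvq.ne, hvr.ne]
  have m2 : p ∉ ({q, r} : Finset V) := by simp [hpq, hpr]
  have m3 : q ∉ ({r} : Finset V) := by simp [hqr]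
  rw [twiceIncident_eq, Finset.sum_insert m1, Finset.sum_insert m2, Finset.sum_insert m3,
    Finset.sum_singleton]
  ring

/-- No triangle of `G - N[v]` sends edges from all of its vertices to `N[v]`, if `v` has degree
three and lies in a triangle. -/
theorem IsDifficultMod.false_of_triangle_claw (hC : ¬ HasTriangleAdjC4 G) {v p q r : V}
    (hv : ∀ z, G.Adj v z ↔ z ∈ ({p, q, r} : Finset V)) (hpq : G.Adj p q)
    (hA : IsDifficultMod G {v, p, q, r} A) (hF : IsCopy (⊤ : SimpleGraph (Fin 3)) G A)
    (htri : ∀ p q r, G.Adj p q → G.Adj q r → G.Adj p r → 3 ≤ deg G p) : False := by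
  have hvp : G.Adj v p := (hv p).2 (by simp)
  have hvq : G.Adj v q := (hv q).2 (by simp)
  have hcard := (hA.boundaryIn_large htri).1
  obtain ⟨w, hw⟩ := hA.nonempty
  obtain ⟨s, t, rfl, hws, hwt, hst⟩ := hF.exists_triangle hw
  have hbd : boundaryIn G {v, p, q, r} {w, s, t} = {w, s, t} :=
    Finset.eq_of_subset_of_card_le (Finset.filter_subset _ _) (Finset.card_le_three.trans hcard)
  have hdis : ∀ x ∈ ({w, s, t} : Finset V), x ∉ ({v, p, q, r} : Finset V) := fun x hx =>
    Finset.disjoint_left.1 hA.disjoint hx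
  have hout : ∀ x ∈ ({w, s, t} : Finset V), G.Adj x p ∨ G.Adj x q ∨ G.Adj x r := by
    intro x hx
    obtain ⟨-, y, hy, hxy⟩ := mem_boundaryIn.1 (hbd.symm ▸ hx)
    simp only [Finset.mem_insert, Finset.mem_singleton] at hy
    rcases hy with rfl | rfl | rfl | rfl
    · exact absurd (Finset.mem_insert_of_mem ((hv x).1 hxy.symm)) (hdis x hx)
    · exact Or.inl hxy
    · exact Or.inr (Or.inl hxy)
    · exact Or.inr (Or.inr hxy)
  have hclique : ∀ x ∈ ({w, s, t} : Finset V), ∀ y ∈ ({w, s, t} : Finset V), x ≠ y →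
      G.Adj x y := by
    intro x hx y hy hxy
    simp only [Finset.mem_insert, Finset.mem_singleton] at hx hy
    rcases hx with rfl | rfl | rfl <;> rcases hy with rfl | rfl | rfl <;>
      first
        | exact absurd rfl hxy
        | assumption
        | exact SimpleGraph.Adj.symm (by assumption)
  have hone : ∀ u ∈ ({v, p, q, r} : Finset V), ∀ x ∈ ({w, s, t} : Finset V),
      ∀ y ∈ ({w, s, t} : Finset V), G.Adj x u → G.Adj y u → x = y := by
    intro u hu x hx y hy hxu hyu
    by_contra hne
    obtain ⟨z, hz, hzx, hzy⟩ : ∃ z ∈ ({w, s, t} : Finset V), z ≠ x ∧ z ≠ y := by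
      by_contra! h
      have hw' := or_iff_not_imp_left.2 (h w (by simp))
      have hs' := or_iff_not_imp_left.2 (h s (by simp))
      have ht' := or_iff_not_imp_left.2 (h t (by simp))
      have n1 := hws.ne
      have n2 := hwt.ne
      have n3 := hst.ne
      clear * - hw' hs' ht' n1 n2 n3
      grind
    have := eq_of_adjacent_triangles hC (hclique x hx y hy hne) (hclique y hy z hz hzy.symm)
      (hclique z hz x hx hzx) hxu hyu
    exact hdis z hz (this ▸ hu)
  have hcross : ∀ x ∈ ({w, s, t} : Finset V), ∀ y ∈ ({w, s, t} : Finset V),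
      G.Adj x p → G.Adj y q → False := by
    intro x hx y hy hxp hyq
    have hx' := hdis x hx
    have hy' := hdis y hy
    simp only [Finset.mem_insert, Finset.mem_singleton, not_or] at hx' hy'
    by_cases hxy : x = y
    · subst hxy
      exact hx'.1 (eq_of_adjacent_triangles hC hpq hvq.symm hvp hxp.symm hyq.symm).symm
    · exact not_triangle_of_adj_of_adj hC hpq hvq.symm hvp hxp.symm hyq.symm
        (hclique x hx y hy hxy) hx'.2.2.1 hy'.2.1
  have ow := hout w (by simp)
  have os := hout s (by simp)
  have ot := hout t (by simp)
  have hne1 := hws.ne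
  have hne2 := hwt.ne
  have hne3 := hst.ne
  simp only [Finset.mem_insert, Finset.mem_singleton, forall_eq_or_imp, forall_eq] at hone hcross
  clear * - ow os ot hne1 hne2 hne3 hone hcross
  grind

/-- Removing four vertices that extend by one independent vertex leaves at most one difficult
component, which is a triangle. -/
theorem IsMinCounterexample.card_difficultSets_le_one {a b : ℝ}
    (hG : IsMinCounterexample a b G) (hb : 0 ≤ b) (h6 : 7 ≤ 10 * a + 16 * b) {K : Finset V}
    (hK : IsExtension G S K) (hc : S.card = 4) (hk : K.card = 1)
    (ht : 16 + 2 * (difficultSets G S).card ≤ twiceIncident G S) :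
    (difficultSets G S).card ≤ 1 ∧
      ∀ A, IsDifficultMod G S A → IsCopy (⊤ : SimpleGraph (Fin 3)) G A := by
  have htri : ∀ A, IsDifficultMod G S A → IsCopy (⊤ : SimpleGraph (Fin 3)) G A := by
    intro A hA
    refine hA.copy.resolve_right fun hF => ?_
    obtain ⟨K', hK', hk', hc', he', hd'⟩ := hA.absorb_chain hF hK
    rw [hk] at hk'
    rw [hc] at hc'
    have := hG.gain_lt_of_le hb (Finset.card_pos.1 (by omega)) hK' hc' hk' (t := 16) (by omega)
    norm_num at this
    linarith
  refine ⟨Finset.card_le_one.2 fun A hA B hB => ?_, htri⟩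
  by_contra hne
  have hA := mem_difficultSets.1 hA
  have hB := mem_difficultSets.1 hB
  obtain ⟨K', hK', hk', hc', he', hd'⟩ := hA.absorb_triangle (htri A hA) hK
  have hB' : IsDifficultMod G (S ∪ A) B :=
    ⟨Finset.disjoint_union_right.2 ⟨hB.disjoint, (hA.disjoint_of_ne hB hne).symm⟩, hB.copy,
      fun x hx y hxy hy => hB.closed x hx y hxy fun h => hy (Finset.mem_union_left _ h)⟩
  obtain ⟨K₂, hK₂, hk₂, hc₂, he₂, hd₂⟩ := hB'.absorb_triangle (htri B hB) hK'
  rw [hk', hk] at hk₂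
  rw [hc', hc] at hc₂
  have := hG.gain_lt_of_le hb (Finset.card_pos.1 (by omega)) hK₂ hc₂ hk₂ (t := 16) (by omega)
  norm_num at this
  linarith

theorem IsMinCounterexample.deg_neighbors_lt {a b : ℝ} (hG : IsMinCounterexample a b G)
    (ha : 0 < a) (hb : 0 ≤ b) (h1 : 1 ≤ 2 * a + b) (h2 : 2 ≤ 3 * a + 4 * b)
    (h3 : 6 ≤ 9 * a + 11 * b) (h5 : 3 ≤ 4 * a + 9 * b) (h6 : 7 ≤ 10 * a + 16 * b) {v p q r : V}
    (hv : ∀ z, G.Adj v z ↔ z ∈ ({p, q, r} : Finset V)) (hpq : p ≠ q) (hpr : p ≠ r) (hqr : q ≠ r)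
    (hnpr : ¬ G.Adj p r) (hnqr : ¬ G.Adj q r) : deg G p + deg G q + deg G r < 10 := by
  by_contra! hdeg
  have htri : ∀ p q r, G.Adj p q → G.Adj q r → G.Adj p r → 3 ≤ deg G p :=
    fun _ _ _ => hG.three_le_deg_of_triangle ha hb h1 h2 h3
  have hvp : G.Adj v p := (hv p).2 (by simp)
  have hvq : G.Adj v q := (hv q).2 (by simp)
  have hvr : G.Adj v r := (hv r).2 (by simp)
  have hl := leaving_claw hvp hvq hvr hpq hpr hqr hnpr hnqr
  have he := twiceIncident_claw hvp hvq hvr hpq hpr hqr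
  have hd := three_mul_card_difficultSets_le_leaving htri {v, p, q, r}
  have hv3 : deg G v = 3 :=
    (deg_eq_card hv).trans (Finset.card_eq_three.2 ⟨p, q, r, hpq, hpr, hqr, rfl⟩)
  have hc : ({v, p, q, r} : Finset V).card = 4 := by
    rw [Finset.card_insert_of_notMem (by simp [hvp.ne, hvq.ne, hvr.ne]), ← deg_eq_card hv, hv3]
  have hK : IsExtension G {v, p, q, r} {v} :=
    isExtension_singleton (by simp) fun z hz => Finset.mem_insert_of_mem ((hv z).1 hz)
  obtain ⟨hd1, hF⟩ := hG.card_difficultSets_le_one hb h6 hK hc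
    (Finset.card_singleton v) (by split_ifs at hl <;> omega)
  have hd0 : G.Adj p q → (difficultSets G {v, p, q, r}).card = 0 := by
    intro h
    rw [Finset.card_eq_zero, Finset.eq_empty_iff_forall_notMem]
    intro A hA
    have hA := mem_difficultSets.1 hA
    exact hA.false_of_triangle_claw hG.noTriangleAdjC4 hv h (hF A hA) htri
  have := hG.gain_lt_of_le hb ⟨v, by simp⟩ hK hc (Finset.card_singleton v) (t := 9) (by
    split_ifs at hl with h
    · have := hd0 h
      omega
    · omega)
  norm_num at this
  linarith

theorem IsMinCounterexample.deg_ne_four_of_adj {a b : ℝ} (hG : IsMinCounterexample a b G)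
    (ha : 0 < a) (hb : 0 ≤ b) (h1 : 1 ≤ 2 * a + b) (h2 : 2 ≤ 3 * a + 4 * b)
    (h3 : 6 ≤ 9 * a + 11 * b) (h5 : 3 ≤ 4 * a + 9 * b) (h6 : 7 ≤ 10 * a + 16 * b) {v u : V}
    (hvu : G.Adj v u) (hv3 : deg G v = 3) : deg G u ≠ 4 := by
  intro hu
  obtain ⟨N, hN, hv⟩ := exists_neighbors_eq (G := G) v
  obtain ⟨p, q, r, hpq, hpr, hqr, rfl⟩ := Finset.card_eq_three.1 (hN.trans hv3)
  have hvp : G.Adj v p := (hv p).2 (by simp)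
  have hvq : G.Adj v q := (hv q).2 (by simp)
  have hvr : G.Adj v r := (hv r).2 (by simp)
  have hdeg : 10 ≤ deg G p + deg G q + deg G r := by
    have hp := hG.three_le_deg ha hb h1 h2 h3 p
    have hq := hG.three_le_deg ha hb h1 h2 h3 q
    have hr := hG.three_le_deg ha hb h1 h2 h3 r
    have := (hv u).1 hvu
    simp only [Finset.mem_insert, Finset.mem_singleton] at this
    rcases this with rfl | rfl | rfl <;> omega
  have key : ∀ x y z, G.Adj v x → G.Adj v y → G.Adj v z → y ≠ z → G.Adj x y → ¬ G.Adj x z :=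
    fun x y z hvx hvy hvz hne hxy hxz =>
      hne (eq_of_adjacent_triangles hG.noTriangleAdjC4 hvx hxy hvy.symm hvz hxz)
  have hle := fun {x y z : V} =>
    hG.deg_neighbors_lt (v := v) (p := x) (q := y) (r := z) ha hb h1 h2 h3 h5 h6
  by_cases h : G.Adj p r
  · have hq1 := key p r q hvp hvr hvq hqr.symm h
    have hq2 := key r p q hvr hvp hvq hpq h.symm
    have := hle (x := p) (y := r) (z := q) (by
      intro z
      rw [hv, Finset.pair_comm q r]) hpr hpq hqr.symm hq1 hq2
    omega
  · by_cases h' : G.Adj q r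
    · have hp2 := key r q p hvr hvq hvp hpq.symm h'.symm
      have := hle (x := q) (y := r) (z := p) (by
        intro z
        rw [hv]
        simp only [Finset.mem_insert, Finset.mem_singleton]
        clear * -
        tauto) hqr hpq.symm hpr.symm (key q r p hvq hvr hvp hpr.symm h') hp2
      omega
    · have := hle hv hpq hpr hqr h h'
      omega

end

/-- Claim 2.10: no degree-3 vertex of a minimum counterexample has a
degree-4 neighbor. -/
theorem claim_deg_three_no_deg_four_neighbor
(a b : ℝ) (ha : 0 < a) (hb : 0 < b)
    (h1 : 2 * a + b ≥ 1) (h2 : 3 * a + 4 * b ≥ 2) (h3 : 9 * a + 11 * b ≥ 6)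
    (h4 : a + 5 * b ≥ 1) (h5 : 4 * a + 9 * b ≥ 3) (h6 : 10 * a + 16 * b ≥ 7)
    (h7 : 13 * a + 20 * b ≥ 8) (h8 : 5 * a + 14 * b ≥ 4)
    (h9 : a + (3 / 2) * b ≥ 2 / 3)
{V : Type} [Fintype V] (G : SimpleGraph V)
    (hG : ¬ HasTriangleAdjC4 G)
    (hcex : (indepNum G : ℝ) <
      (Nat.card V : ℝ) - (a * Nat.card V + b * numEdges G + b * lambda G))
    (hmin : ∀ (W : Type) [Fintype W] (G' : SimpleGraph W),
      Nat.card W < Nat.card V → ¬ HasTriangleAdjC4 G' →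
      (indepNum G' : ℝ) ≥
        (Nat.card W : ℝ) - (a * Nat.card W + b * numEdges G' + b * lambda G')) :
    ∀ v u : V, G.Adj v u → deg G v = 3 → deg G u ≠ 4 := by
  intro v u hvu hv
  exact IsMinCounterexample.deg_ne_four_of_adj ⟨hG, hcex, hmin⟩ ha hb.le h1 h2 h3 h5 h6 hvu hv

end Paper
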